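/- arXiv:2505.20689 — 2 statements merged into one kernel-verified Lean document; each statement's English description precedes it below -/
import Mathlib

section
/- For any controls f, g define the Blagoveshchenskii function ψ_{n,t} := ∑_{k=1}^∞ u^f_{k,n}·conj(v^g_{k,t}) (the sum is finite since u^f_{k,n} = 0 for k > n). Then ψ_{0,t} = 0 and ψ_{n,0} = 0, and for all n ≥ 1, t ≥ 1: ψ_{n,t+1} + ψ_{n,t−1} − ψ_{n+1,t} − ψ_{n−1,t} = a_0·( u^f_{1,n}·conj(g_t) − f_n·conj(v^g_{1,t}) ). -/
open Finset Matrix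

noncomputable section

/-- `IsWave a b f u` means `u` is the wave of the dynamical system with
off-diagonal coefficients `a = (a_n)_{n ≥ 0}`, diagonal coefficients
`b = (b_n)_{n ≥ 1}` and boundary control `f`:
`u_{n,-1} = u_{n,0} = 0` for `n ≥ 1`, `u_{0,t} = f_t` for `t ≥ 0`, and
`u_{n,t+1} + u_{n,t-1} - a_n u_{n+1,t} - a_{n-1} u_{n-1,t} - b_n u_{n,t} = 0`
for `n ≥ 1`, `t ≥ 0`. -/
def IsWave (a b f : ℕ → ℂ) (u : ℕ → ℤ → ℂ) : Prop :=
  (∀ n : ℕ, 1 ≤ n → u n (-1) = 0) ∧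
  (∀ n : ℕ, 1 ≤ n → u n 0 = 0) ∧
  (∀ t : ℕ, u 0 (t : ℤ) = f t) ∧
  (∀ n : ℕ, 1 ≤ n → ∀ t : ℤ, 0 ≤ t →
    u n (t + 1) + u n (t - 1) - a n * u (n + 1) t - a (n - 1) * u (n - 1) t
      - b n * u n t = 0)

/-- The special control `δ = (1,0,0,…)`. -/
def deltaCtrl : ℕ → ℂ := fun t => if t = 0 then 1 else 0

/-- Extension of a control `f ∈ ℂ^T` by zero to all of `ℕ`. -/
def extendCtrl (T : ℕ) (f : Fin T → ℂ) : ℕ → ℂ :=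
  fun t => if h : t < T then f ⟨t, h⟩ else 0

/-- Finite speed of propagation: a wave vanishes beyond the light cone. -/
theorem IsWave.eq_zero_of_lt {a b f : ℕ → ℂ} {u : ℕ → ℤ → ℂ} (hu : IsWave a b f u)
    {k t : ℕ} (hk : t < k) : u k (t : ℤ) = 0 := by
  obtain ⟨h₁, h₀, -, hrec⟩ := hu
  suffices h : ∀ t : ℕ, ∀ k : ℕ, t < k → u k (t : ℤ) = 0 ∧ u k ((t : ℤ) - 1) = 0 from
    (h t k hk).1
  intro t
  induction t with
  | zero =>
    intro k hk
    exact ⟨by simpa using h₀ k hk, by simpa using h₁ k hk⟩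
  | succ t ih =>
    intro k hk
    obtain ⟨hk₀, hk₁⟩ := ih k (by omega)
    have h := hrec k (by omega) t (by omega)
    rw [hk₁, (ih (k + 1) (by omega)).1, (ih (k - 1) (by omega)).1, hk₀] at h
    push_cast
    exact ⟨by simpa using h, by simpa using hk₀⟩

/-- Lagrange's identity for a complex Jacobi operator. -/
theorem sum_range_jacobi_lagrange (a b x y : ℕ → ℂ) (N : ℕ) :
    ∑ k ∈ range N,
        (x (k + 1) * (a (k + 1) * y (k + 2) + a k * y k + b (k + 1) * y (k + 1))
          - (a (k + 1) * x (k + 2) + a k * x k + b (k + 1) * x (k + 1)) * y (k + 1))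
      = a N * (x N * y (N + 1) - x (N + 1) * y N) - a 0 * (x 0 * y 1 - x 1 * y 0) := by
  rw [← Finset.sum_range_sub (fun k => a k * (x k * y (k + 1) - x (k + 1) * y k))]
  exact Finset.sum_congr rfl fun k _ => by ring

/-- the Blagoveshchenskii function
`ψ_{n,t} = ∑_{k=1}^∞ u^f_{k,n} conj (v^g_{k,t})` vanishes for `n = 0` and for
`t = 0`, and satisfies the inhomogeneous discrete wave equation. -/
theorem blagoveshchenskii_function
    (a b f g : ℕ → ℂ) (ha : ∀ n, a n ≠ 0)
    (u v : ℕ → ℤ → ℂ)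
    (hu : IsWave a b f u)
    (hv : IsWave (fun n => (starRingEnd ℂ) (a n))
      (fun n => (starRingEnd ℂ) (b n)) g v)
    (ψ : ℕ → ℕ → ℂ)
    (hψ : ∀ n t : ℕ,
      ψ n t = ∑' k : ℕ, u (k + 1) (n : ℤ) * (starRingEnd ℂ) (v (k + 1) (t : ℤ))) :
    (∀ t : ℕ, ψ 0 t = 0) ∧ (∀ n : ℕ, ψ n 0 = 0) ∧
    (∀ n t : ℕ, 1 ≤ n → 1 ≤ t →
      ψ n (t + 1) + ψ n (t - 1) - ψ (n + 1) t - ψ (n - 1) t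
        = a 0 * (u 1 (n : ℤ) * (starRingEnd ℂ) (g t)
            - f n * (starRingEnd ℂ) (v 1 (t : ℤ)))) := by
  have hsum : ∀ n t N : ℕ, n ≤ N →
      ψ n t = ∑ k ∈ range N, u (k + 1) (n : ℤ) * (starRingEnd ℂ) (v (k + 1) (t : ℤ)) := by
    intro n t N hN
    rw [hψ]
    refine tsum_eq_sum fun k hk => ?_
    rw [Finset.mem_range] at hk
    rw [hu.eq_zero_of_lt (by omega), zero_mul]
  refine ⟨fun t => by simpa using hsum 0 t 0 le_rfl, fun n => ?_, fun n t hn ht => ?_⟩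
  · rw [hsum n 0 n le_rfl]
    refine Finset.sum_eq_zero fun k _ => ?_
    rw [hv.eq_zero_of_lt (Nat.succ_pos k), map_zero, mul_zero]
  obtain ⟨m, rfl⟩ := Nat.exists_eq_add_of_le' hn
  obtain ⟨s, rfl⟩ := Nat.exists_eq_add_of_le' ht
  have key := sum_range_jacobi_lagrange a b (fun k => u k ((m + 1 : ℕ) : ℤ))
    (fun k => (starRingEnd ℂ) (v k ((s + 1 : ℕ) : ℤ))) (m + 2)
  rw [hu.eq_zero_of_lt (show m + 1 < m + 2 by omega),
    hu.eq_zero_of_lt (show m + 1 < m + 2 + 1 by omega), hu.2.2.1, hv.2.2.1] at key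
  rw [hsum _ _ (m + 2) (by omega), hsum _ _ (m + 2) (by omega),
    hsum _ _ (m + 2) (by omega), hsum _ _ (m + 2) (by omega), ← Finset.sum_add_distrib,
    ← Finset.sum_sub_distrib, ← Finset.sum_sub_distrib]
  refine Eq.trans (Finset.sum_congr rfl fun k _ => ?_) (key.trans (by ring))
  have hU := hu.2.2.2 (k + 1) (by omega) ((m + 1 : ℕ) : ℤ) (by omega)
  have hV := congrArg (starRingEnd ℂ)
    (hv.2.2.2 (k + 1) (by omega) ((s + 1 : ℕ) : ℤ) (by omega))
  simp only [map_sub, map_add, map_mul, map_zero, Complex.conj_conj] at hV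
  push_cast at hU hV ⊢
  simp only [add_tsub_cancel_right] at hU hV ⊢
  linear_combination (u (k + 1) ((m : ℤ) + 1)) * hV
    - (starRingEnd ℂ) (v (k + 1) ((s : ℤ) + 1)) * hU
end
end

section
/- The response vector depends only on a_0, the squares (a_k)² (k ≥ 1), and the b_k: if ε_m ∈ {1,−1} for m ≥ 1 and a'_0 = a_0, a'_m = ε_m a_m for m ≥ 1, then the response vector r' of the system with coefficients (a'_n), (b_n) satisfies r'_s = r_s for all s ≥ 0. -/
open Finset Matrix

noncomputable section

/-- The wave is determined on `n ≥ 0`, `t ≥ 0` by the coefficients and the control. -/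
theorem IsWave.unique {a b f : ℕ → ℂ} {u v : ℕ → ℤ → ℂ}
    (hu : IsWave a b f u) (hv : IsWave a b f v) (n t : ℕ) : u n t = v n t := by
  obtain ⟨hu₁, hu₀, hub, hur⟩ := hu
  obtain ⟨hv₁, hv₀, hvb, hvr⟩ := hv
  suffices h : ∀ t : ℕ, (∀ n, u n t = v n t) ∧
      ∀ n, 1 ≤ n → u n ((t : ℤ) - 1) = v n ((t : ℤ) - 1) from (h t).1 n
  intro t
  induction t with
  | zero =>
    refine ⟨fun n => ?_, fun n hn => by simp [hu₁ n hn, hv₁ n hn]⟩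
    rcases Nat.eq_zero_or_pos n with rfl | hn
    · rw [hub, hvb]
    · simp [hu₀ n hn, hv₀ n hn]
  | succ t ih =>
    obtain ⟨ih, ih_prev⟩ := ih
    refine ⟨fun n => ?_, fun n _ => by simpa using ih n⟩
    rcases Nat.eq_zero_or_pos n with rfl | hn
    · rw [hub, hvb]
    · have h₁ := hur n hn t (by positivity)
      have h₂ := hvr n hn t (by positivity)
      rw [ih_prev n hn, ih n, ih (n + 1), ih (n - 1)] at h₁
      push_cast
      linear_combination h₁ - h₂

/-- Flipping the signs of the off-diagonal coefficients multiplies the wave at site `n` by the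
product of the signs below `n`. -/
theorem IsWave.mul_prod_signs {a b f η : ℕ → ℂ} {u : ℕ → ℤ → ℂ} (hu : IsWave a b f u)
    (hη : ∀ m, η m * η m = 1) :
    IsWave (fun n => η n * a n) b f (fun n t => (∏ m ∈ range n, η m) * u n t) := by
  obtain ⟨hu₁, hu₀, hub, hur⟩ := hu
  refine ⟨fun n hn => by simp [hu₁ n hn], fun n hn => by simp [hu₀ n hn],
    fun t => by simp [hub], fun n hn t ht => ?_⟩
  obtain ⟨k, rfl⟩ := Nat.exists_eq_add_of_le' hn
  have h := hur (k + 1) hn t ht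
  simp only [Nat.add_sub_cancel, prod_range_succ] at h ⊢
  linear_combination (∏ m ∈ range k, η m) * η k * h -
    (∏ m ∈ range k, η m) * η k * a (k + 1) * u (k + 1 + 1) t * hη (k + 1)

/-- the response vector depends only on `a_0`, the squares
`(a_k)²` and the `b_k`: flipping signs of the `a_m` (`m ≥ 1`) does not change
the response vector. -/
theorem response_independent_of_signs
    (a b : ℕ → ℂ) (ha : ∀ n, a n ≠ 0)
    (ε : ℕ → ℂ) (hε : ∀ m : ℕ, 1 ≤ m → ε m = 1 ∨ ε m = -1)
    (a' : ℕ → ℂ) (ha'0 : a' 0 = a 0) (ha' : ∀ m : ℕ, 1 ≤ m → a' m = ε m * a m)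
    (u u' : ℕ → ℤ → ℂ)
    (hu : IsWave a b deltaCtrl u) (hu' : IsWave a' b deltaCtrl u') :
    ∀ s : ℕ, u' 1 ((s : ℤ) + 1) = u 1 ((s : ℤ) + 1) := by
  set η : ℕ → ℂ := fun m => if m = 0 then 1 else ε m with hη_def
  have hη₀ : η 0 = 1 := by simp [hη_def]
  have hη : ∀ m, η m * η m = 1 := by
    intro m
    rcases Nat.eq_zero_or_pos m with rfl | hm
    · simp [hη₀]
    · rcases hε m hm with h | h <;> simp [hη_def, hm.ne', h]
  have ha'_eq : a' = fun n => η n * a n := by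
    funext m
    rcases Nat.eq_zero_or_pos m with rfl | hm
    · simp [hη₀, ha'0]
    · simp [hη_def, hm.ne', ha' m hm]
  rw [ha'_eq] at hu'
  intro s
  simpa [hη₀] using hu'.unique (hu.mul_prod_signs hη) 1 (s + 1)
end
end
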